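/- Let n ≥ p be positive integers and γ > 0. For every c > 0 and every 0 < ε < 1 there exist η > 0 and α > 0 with the following property: for every sequence φ : ℕ → ℝ^{n×p} with ‖φ_k‖ ≤ c for all k, and every sequence θ : ℕ → ℝ^{n×p} satisfying θ₀ᵀθ₀ = I and the update rule θ_{k+1} = θ_k + η·[φ_k − θ_k(2I − θ_kᵀθ_k)·Sym(θ_kᵀφ_k) − (α/4)·θ_k(θ_kᵀθ_k − I)] for all k, one has ‖θ_kᵀθ_k − I‖ ≤ ε for all k. -/

import Mathlib

open Matrix Set Filter

attribute [local instance] Matrix.normedAddCommGroup Matrix.normedSpace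

noncomputable section

/-- `Sym(A) = (A + Aᵀ)/2`. -/
def symPart {p : ℕ} (A : Matrix (Fin p) (Fin p) ℝ) : Matrix (Fin p) (Fin p) ℝ :=
  (1 / 2 : ℝ) • (A + Aᵀ)

/-- Euclidean (Frobenius) inner product `⟨A, B⟩ = tr(AᵀB)`. -/
def mInner {m k : ℕ} (A B : Matrix (Fin m) (Fin k) ℝ) : ℝ := (Aᵀ * B).trace

/-- The norm induced from `mInner`. -/
def mNorm {m k : ℕ} (A : Matrix (Fin m) (Fin k) ℝ) : ℝ := Real.sqrt (mInner A A)

section FrobeniusAux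

attribute [local instance] Matrix.frobeniusNormedAddCommGroup Matrix.frobeniusNormedSpace

theorem mNorm_sq_sum {m k : ℕ} (A : Matrix (Fin m) (Fin k) ℝ) :
    mInner A A = ∑ i, ∑ j, A i j ^ 2 := by
  unfold mInner
  simp only [Matrix.trace, Matrix.diag, Matrix.mul_apply, Matrix.transpose_apply]
  rw [Finset.sum_comm]
  simp only [sq]

theorem mNorm_eq_frob {m k : ℕ} (A : Matrix (Fin m) (Fin k) ℝ) :
    mNorm A = ‖A‖ := by
  rw [Matrix.frobenius_norm_def, mNorm, mNorm_sq_sum, Real.sqrt_eq_rpow]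
  simp

theorem mNorm_nonneg' {m k : ℕ} (A : Matrix (Fin m) (Fin k) ℝ) : 0 ≤ mNorm A :=
  Real.sqrt_nonneg _

theorem mNorm_add_le' {m k : ℕ} (A B : Matrix (Fin m) (Fin k) ℝ) :
    mNorm (A + B) ≤ mNorm A + mNorm B := by
  simp only [mNorm_eq_frob]; exact norm_add_le A B

theorem mNorm_sub_le' {m k : ℕ} (A B : Matrix (Fin m) (Fin k) ℝ) :
    mNorm (A - B) ≤ mNorm A + mNorm B := by
  simp only [mNorm_eq_frob]; exact norm_sub_le A B

theorem mNorm_mul_le' {m k l : ℕ} (A : Matrix (Fin m) (Fin k) ℝ) (B : Matrix (Fin k) (Fin l) ℝ) :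
    mNorm (A * B) ≤ mNorm A * mNorm B := by
  simp only [mNorm_eq_frob]; exact Matrix.frobenius_norm_mul A B

theorem mNorm_transpose' {m k : ℕ} (A : Matrix (Fin m) (Fin k) ℝ) :
    mNorm Aᵀ = mNorm A := by
  simp only [mNorm_eq_frob]; exact Matrix.frobenius_norm_transpose A

theorem mNorm_smul' {m k : ℕ} (r : ℝ) (hr : 0 ≤ r) (A : Matrix (Fin m) (Fin k) ℝ) :
    mNorm (r • A) = r * mNorm A := by
  have h : mInner (r • A) (r • A) = r ^ 2 * mInner A A := by
    simp only [mNorm_sq_sum, Finset.mul_sum, Matrix.smul_apply, smul_eq_mul, mul_pow]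
  rw [mNorm, h, Real.sqrt_mul (sq_nonneg r), Real.sqrt_sq hr, mNorm]

end FrobeniusAux

theorem mNorm_symPart {p : ℕ} (A : Matrix (Fin p) (Fin p) ℝ) : mNorm (symPart A) ≤ mNorm A := by
  unfold symPart
  rw [mNorm_smul' _ (by norm_num)]
  have := mNorm_add_le' A Aᵀ
  rw [mNorm_transpose'] at this
  linarith

theorem entry_le_mNorm {p : ℕ} (A : Matrix (Fin p) (Fin p) ℝ) (i : Fin p) : A i i ≤ mNorm A := by
  apply Real.le_sqrt_of_sq_le
  rw [mNorm_sq_sum]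
  calc A i i ^ 2 ≤ ∑ j, A i j ^ 2 :=
        Finset.single_le_sum (f := fun j => A i j ^ 2) (fun _ _ => sq_nonneg _) (Finset.mem_univ i)
    _ ≤ _ := Finset.single_le_sum (f := fun i => ∑ j, A i j ^ 2)
        (fun _ _ => Finset.sum_nonneg fun _ _ => sq_nonneg _) (Finset.mem_univ i)

theorem mNorm_theta {n p : ℕ} (T : Matrix (Fin n) (Fin p) ℝ) (h : mNorm (Tᵀ * T - 1) ≤ 1) :
    mNorm T ≤ 2 * p + 1 := by
  unfold mNorm mInner
  apply Real.sqrt_le_iff.2 ⟨by positivity, ?_⟩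
  have : (Tᵀ * T).trace ≤ ∑ _i : Fin p, (2 : ℝ) := by
    apply Finset.sum_le_sum
    intro i _
    have := (entry_le_mNorm (Tᵀ * T - 1) i).trans h
    simp only [Matrix.sub_apply, Matrix.one_apply_eq] at this
    simp only [Matrix.diag]
    linarith
  simp at this
  nlinarith [(Nat.cast_nonneg p : (0 : ℝ) ≤ p)]

theorem symPart_transpose {p : ℕ} (A : Matrix (Fin p) (Fin p) ℝ) :
    (symPart A)ᵀ = symPart A := by
  unfold symPart
  rw [Matrix.transpose_smul, Matrix.transpose_add, Matrix.transpose_transpose, add_comm]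

/-- Exact one-step recursion for the constraint error. -/
theorem step_identity {n p : ℕ} (T F G : Matrix (Fin n) (Fin p) ℝ)
    (E s : Matrix (Fin p) (Fin p) ℝ) (η α : ℝ)
    (hE : E = Tᵀ * T - 1) (hs : s = symPart (Tᵀ * F))
    (hG : G = F - T * ((2 : ℝ) • (1 : Matrix (Fin p) (Fin p) ℝ) - Tᵀ * T) * s - (α / 4) • (T * E)) :
    (T + η • G)ᵀ * (T + η • G) - 1 =
      (1 - η * α / 2) • E - (η * α / 2) • (E * E) + η • (E * E * s + s * (E * E))
        + (η • G)ᵀ * (η • G) := by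
  have hST : Tᵀ * T = 1 + E := by rw [hE]; abel
  have hEt : Eᵀ = E := by rw [hE]; simp
  have hst : sᵀ = s := by rw [hs, symPart_transpose]
  have h2 : Tᵀ * F + (Tᵀ * F)ᵀ = (2 : ℝ) • s := by
    rw [hs, symPart, smul_smul]; norm_num
  have h3 : (2 : ℝ) • (1 : Matrix (Fin p) (Fin p) ℝ) - Tᵀ * T = 1 - E := by
    rw [hST, two_smul]; abel
  have h4 : Tᵀ * G = Tᵀ * F - (s - E * E * s) - (α / 4) • (E + E * E) := by
    rw [hG, h3, Matrix.mul_sub, Matrix.mul_sub, Matrix.mul_smul, ← Matrix.mul_assoc,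
      ← Matrix.mul_assoc, ← Matrix.mul_assoc, hST]
    congr 2
    · noncomm_ring
    · noncomm_ring
  have h5 : Gᵀ * T = (Tᵀ * F)ᵀ - (s - s * (E * E)) - (α / 4) • (E + E * E) := by
    have : Gᵀ * T = (Tᵀ * G)ᵀ := by simp
    rw [this, h4]
    simp only [Matrix.transpose_sub, Matrix.transpose_smul, Matrix.transpose_add,
      Matrix.transpose_mul Tᵀ F, Matrix.transpose_mul E E, Matrix.transpose_mul (E * E) s, hEt, hst]
  have h6 : (Tᵀ * F)ᵀ = (2 : ℝ) • s - Tᵀ * F := by rw [← h2]; abel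
  rw [h6] at h5
  have h7 : (T + η • G)ᵀ * (T + η • G) =
      Tᵀ * T + η • (Tᵀ * G) + η • (Gᵀ * T) + (η • G)ᵀ * (η • G) := by
    rw [Matrix.transpose_add, Matrix.add_mul, Matrix.mul_add, Matrix.mul_add]
    rw [Matrix.mul_smul Tᵀ η G, Matrix.transpose_smul, Matrix.smul_mul η Gᵀ T]
    abel
  rw [h7, h4, h5, hST]
  module

theorem final_bound (ε β M c D η e : ℝ) (hε : 0 < ε) (hε1 : ε < 1) (hM : 1 ≤ M) (hc : 0 < c)
    (hD : 0 ≤ D) (hβ : β = (1 - ε) / M ^ 2) (hη : 0 < η) (hη1 : η ≤ 1)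
    (hηQ : η * (2 * (M * c) + D ^ 2 + D * M) ≤ ε * β * (1 - ε) / 2) (he : 0 ≤ e) (heε : e ≤ ε) :
    (1 - β) * e + β * (e * e) + η * (e * e * (M * c) + M * c * (e * e))
      + (η * D + β / 2 * (M * e)) * (η * D + β / 2 * (M * e)) ≤ ε := by
  have hM2 : 1 ≤ M ^ 2 := one_le_pow₀ hM
  have hβM : β * M ^ 2 = 1 - ε := by rw [hβ]; field_simp
  have hβ0 : 0 < β := by rw [hβ]; apply div_pos <;> linarith
  have hβ1 : β ≤ 1 := by nlinarith
  have h1 : 0 ≤ 1 - β := by linarith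
  have hM0 : 0 ≤ M := by linarith
  have step : (1 - β) * e + β * (e * e) + η * (e * e * (M * c) + M * c * (e * e))
      + (η * D + β / 2 * (M * e)) * (η * D + β / 2 * (M * e)) ≤
      (1 - β) * ε + β * (ε * ε) + η * (1 * 1 * (M * c) + M * c * (1 * 1))
      + (η * D + β / 2 * (M * ε)) * (η * D + β / 2 * (M * ε)) := by
    have : e ≤ 1 := by linarith
    gcongr
  refine step.trans ?_
  have a1 : (η * D) * (η * D) ≤ η * D ^ 2 := by
    have : 0 ≤ η * D ^ 2 := by positivity
    nlinarith
  have a2 : η * D * (β * (M * ε)) ≤ η * D * (1 * (M * 1)) := by gcongr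
  have a3 : (β / 2 * (M * ε)) * (β / 2 * (M * ε)) = β * (1 - ε) * ε * ε / 4 := by
    rw [← hβM]; ring
  have a4 : β * (1 - ε) * ε * ε ≤ β * (1 - ε) * ε * 1 := by
    have : 0 ≤ 1 - ε := by linarith
    gcongr
  have a5 : 0 ≤ β * (1 - ε) * ε := by
    have : 0 ≤ 1 - ε := by linarith
    positivity
  nlinarith

/-- Theorem 3: numerical stability of the θ-update of the FGD
algorithm with the truncated Neumann approximation `(θᵀθ)⁻¹ ≈ 2I - θᵀθ`. -/
theorem stmt14 (n p : ℕ) (hp : 0 < p) (hpn : p ≤ n)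
    (γ : ℝ) (hγ : 0 < γ) :
    ∀ c > (0 : ℝ), ∀ ε : ℝ, 0 < ε → ε < 1 →
      ∃ η > (0 : ℝ), ∃ α > (0 : ℝ),
        ∀ φ : ℕ → Matrix (Fin n) (Fin p) ℝ, (∀ k, mNorm (φ k) ≤ c) →
        ∀ θ : ℕ → Matrix (Fin n) (Fin p) ℝ, (θ 0)ᵀ * θ 0 = 1 →
        (∀ k, θ (k + 1) = θ k + η •
          (φ k - θ k * ((2 : ℝ) • (1 : Matrix (Fin p) (Fin p) ℝ) - (θ k)ᵀ * θ k) *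
              symPart ((θ k)ᵀ * φ k) -
            (α / 4) • (θ k * ((θ k)ᵀ * θ k - 1)))) →
        ∀ k, mNorm ((θ k)ᵀ * θ k - 1) ≤ ε := by
  intro c hc ε hε hε1
  set M : ℝ := 2 * p + 1 with hM
  have hM1 : 1 ≤ M := by rw [hM]; have : (0 : ℝ) ≤ p := Nat.cast_nonneg p; linarith
  have hM0 : 0 ≤ M := by linarith
  set K : ℝ := mNorm (1 : Matrix (Fin p) (Fin p) ℝ) + 1 with hK
  have hK0 : 0 ≤ K := by rw [hK]; have := mNorm_nonneg' (1 : Matrix (Fin p) (Fin p) ℝ); linarith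
  set D : ℝ := c + M * K * (M * c) with hD
  have hD0 : 0 ≤ D := by rw [hD]; positivity
  set β : ℝ := (1 - ε) / M ^ 2 with hβ
  have hβ0 : 0 < β := by rw [hβ]; apply div_pos; linarith; positivity
  have hβ1 : β ≤ 1 := by
    rw [hβ, div_le_one (by positivity)]
    have := one_le_pow₀ hM1 (n := 2)
    linarith
  set Q : ℝ := 2 * (M * c) + D ^ 2 + D * M with hQ
  have hQ0 : 0 < Q := by
    have : 0 < M * c := by positivity
    have : 0 ≤ D * M := by positivity
    have : 0 ≤ D ^ 2 := by positivity
    rw [hQ]; linarith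
  have hsl : 0 < ε * β * (1 - ε) / 2 := by
    have : 0 < 1 - ε := by linarith
    positivity
  set η : ℝ := min 1 (ε * β * (1 - ε) / 2 / Q) with hη
  have hη0 : 0 < η := lt_min one_pos (div_pos hsl hQ0)
  have hη1 : η ≤ 1 := min_le_left _ _
  have hηQ : η * Q ≤ ε * β * (1 - ε) / 2 := by
    rw [← le_div_iff₀ hQ0]; exact min_le_right _ _
  refine ⟨η, hη0, 2 * β / η, by positivity, ?_⟩
  intro φ hφ θ h0 hrec k
  induction k with
  | zero =>
    rw [h0, sub_self]
    have : mNorm (0 : Matrix (Fin p) (Fin p) ℝ) = 0 := by simp [mNorm, mInner]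
    rw [this]; exact hε.le
  | succ k ih =>
    have hr := hrec k
    have hF := hφ k
    set T := θ k
    set F := φ k
    obtain ⟨E, hE⟩ : ∃ E, E = Tᵀ * T - 1 := ⟨_, rfl⟩
    obtain ⟨s, hs⟩ : ∃ s, s = symPart (Tᵀ * F) := ⟨_, rfl⟩
    obtain ⟨G, hG⟩ : ∃ G, G = F - T * ((2 : ℝ) • (1 : Matrix (Fin p) (Fin p) ℝ) - Tᵀ * T) * s
      - (2 * β / η / 4) • (T * E) := ⟨_, rfl⟩
    have hT : mNorm T ≤ M := mNorm_theta T (ih.trans hε1.le)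
    have hr' : θ (k + 1) = T + η • G := by rw [hr, hG, hE, hs]
    rw [hr', step_identity T F G E s η (2 * β / η) hE hs hG]
    rw [← hE] at ih
    have hab : η * (2 * β / η) / 2 = β := by field_simp
    rw [hab]
    have e0 := mNorm_nonneg' E
    have hsn : mNorm s ≤ M * c := by
      rw [hs]
      refine (mNorm_symPart _).trans ((mNorm_mul_le' _ _).trans ?_)
      rw [mNorm_transpose']
      exact mul_le_mul hT hF (mNorm_nonneg' _) hM0
    have hs0 := mNorm_nonneg' s
    have hKn : mNorm ((2 : ℝ) • (1 : Matrix (Fin p) (Fin p) ℝ) - Tᵀ * T) ≤ K := by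
      have : (2 : ℝ) • (1 : Matrix (Fin p) (Fin p) ℝ) - Tᵀ * T = 1 - E := by
        rw [hE, two_smul]; abel
      rw [this]
      refine (mNorm_sub_le' _ _).trans ?_
      rw [hK]; linarith
    have hTE : mNorm (T * E) ≤ M * mNorm E :=
      (mNorm_mul_le' _ _).trans (mul_le_mul_of_nonneg_right hT e0)
    have hη2 : η • G = η • (F - T * ((2 : ℝ) • (1 : Matrix (Fin p) (Fin p) ℝ) - Tᵀ * T) * s)
        - (β / 2) • (T * E) := by
      rw [hG, smul_sub, smul_smul η (2 * β / η / 4)]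
      congr 2
      field_simp
      norm_num
    have hGn : mNorm (η • G) ≤ η * D + β / 2 * (M * mNorm E) := by
      rw [hη2]
      refine (mNorm_sub_le' _ _).trans ?_
      rw [mNorm_smul' η hη0.le, mNorm_smul' (β / 2) (by positivity)]
      have : mNorm (F - T * ((2 : ℝ) • (1 : Matrix (Fin p) (Fin p) ℝ) - Tᵀ * T) * s) ≤ D := by
        refine (mNorm_sub_le' _ _).trans ?_
        rw [hD]
        refine add_le_add hF ((mNorm_mul_le' _ _).trans ?_)
        refine mul_le_mul ((mNorm_mul_le' _ _).trans ?_) hsn hs0 (by positivity)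
        exact mul_le_mul hT hKn (mNorm_nonneg' _) hM0
      gcongr
    have hEE := mNorm_mul_le' E E
    have hx1 : mNorm (E * E * s) ≤ mNorm E * mNorm E * (M * c) :=
      (mNorm_mul_le' _ _).trans (mul_le_mul hEE hsn hs0 (by positivity))
    have hx2 : mNorm (s * (E * E)) ≤ M * c * (mNorm E * mNorm E) :=
      (mNorm_mul_le' _ _).trans (mul_le_mul hsn hEE (mNorm_nonneg' _) (by positivity))
    have hGG : mNorm ((η • G)ᵀ * (η • G)) ≤
        (η * D + β / 2 * (M * mNorm E)) * (η * D + β / 2 * (M * mNorm E)) := by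
      refine (mNorm_mul_le' _ _).trans ?_
      rw [mNorm_transpose']
      exact mul_le_mul hGn hGn (mNorm_nonneg' _) (by positivity)
    refine le_trans ?_ (final_bound ε β M c D η (mNorm E) hε hε1 hM1 hc hD0 hβ hη0 hη1 hηQ e0 ih)
    refine (mNorm_add_le' _ _).trans (add_le_add ?_ hGG)
    refine (mNorm_add_le' _ _).trans (add_le_add ?_ ?_)
    · refine (mNorm_sub_le' _ _).trans ?_
      rw [mNorm_smul' _ (by linarith), mNorm_smul' _ hβ0.le]
      gcongr
    · rw [mNorm_smul' _ hη0.le]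
      refine mul_le_mul_of_nonneg_left ?_ hη0.le
      exact (mNorm_add_le' _ _).trans (add_le_add hx1 hx2)
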